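/- arXiv:0709.2215 — 7 statements merged into one kernel-verified Lean document; each statement's English description precedes it below -/
import Mathlib

section
/- Let x, y : ℝ → S³ ⊂ ℝ⁴ be C¹ closed curves, periodic with periods L₁ > 0 and L₂ > 0 respectively, whose images are disjoint (x(s) ≠ y(t) for all s, t). Then the signed area of the product torus of the link vanishes: ∫₀^{L₁} ∫₀^{L₂} A(s,t) dt ds = 0. -/
open Matrix intervalIntegral

/-- Distinct points of the unit sphere have dot product different from one. -/
lemma dotProduct_ne_one_of_ne {n : Type*} [Fintype n] {u v : n → ℝ}
    (hu : u ⬝ᵥ u = 1) (hv : v ⬝ᵥ v = 1) (huv : u ≠ v) : u ⬝ᵥ v ≠ 1 := by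
  intro h
  apply huv
  rw [← sub_eq_zero, ← dotProduct_self_eq_zero]
  simp only [sub_dotProduct, dotProduct_sub, dotProduct_comm v u, hu, hv, h]
  norm_num

/-- The derivative of the dot product of a curve with a fixed vector. -/
lemma hasDerivAt_dotProduct_const {n : Type*} [Fintype n] {x : ℝ → n → ℝ} {x' : n → ℝ} {s : ℝ}
    (hx : HasDerivAt x x' s) (v : n → ℝ) :
    HasDerivAt (fun s => x s ⬝ᵥ v) (x' ⬝ᵥ v) s :=
  HasDerivAt.fun_sum fun i _ => (hasDerivAt_pi.1 hx i).mul_const (v i)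

/-- For C¹ closed curves `x, y : ℝ → S³ ⊂ ℝ⁴` with disjoint images,
the signed area of the product torus of the link vanishes. -/
theorem signed_area_of_product_torus_vanishes
    (x y : ℝ → (Fin 4 → ℝ)) (L₁ L₂ : ℝ)
    (hx : ContDiff ℝ 1 x) (hy : ContDiff ℝ 1 y)
    (hxS : ∀ s, x s ⬝ᵥ x s = 1) (hyS : ∀ t, y t ⬝ᵥ y t = 1)
    (hL₁ : 0 < L₁) (hL₂ : 0 < L₂)
    (hperx : ∀ s, x (s + L₁) = x s) (hpery : ∀ t, y (t + L₂) = y t)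
    (hdisj : ∀ s t, x s ≠ y t) :
    (∫ s in (0:ℝ)..L₁, ∫ t in (0:ℝ)..L₂,
      ((deriv x s ⬝ᵥ deriv y t) * (x s ⬝ᵥ y t - 1)
        - (deriv x s ⬝ᵥ y t) * (x s ⬝ᵥ deriv y t)) / (x s ⬝ᵥ y t - 1) ^ 2) = 0 := by
  have hne : ∀ s t, x s ⬝ᵥ y t - 1 ≠ 0 := fun s t =>
    sub_ne_zero.2 (dotProduct_ne_one_of_ne (hxS s) (hyS t) (hdisj s t))
  have hcx : Continuous x := hx.continuous
  have hcy : Continuous y := hy.continuous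
  have hcx' : Continuous (deriv x) := hx.continuous_deriv le_rfl
  have hcy' : Continuous (deriv y) := hy.continuous_deriv le_rfl
  have hcont : Continuous (Function.uncurry fun s t =>
      ((deriv x s ⬝ᵥ deriv y t) * (x s ⬝ᵥ y t - 1)
        - (deriv x s ⬝ᵥ y t) * (x s ⬝ᵥ deriv y t)) / (x s ⬝ᵥ y t - 1) ^ 2) := by
    refine Continuous.div ?_ ?_ fun p => pow_ne_zero 2 (hne p.1 p.2)
    · simp only [dotProduct]
      fun_prop
    · simp only [dotProduct]
      fun_prop
  have hderiv : ∀ s t, HasDerivAt (fun s => (x s ⬝ᵥ deriv y t) / (x s ⬝ᵥ y t - 1))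
      (((deriv x s ⬝ᵥ deriv y t) * (x s ⬝ᵥ y t - 1)
        - (deriv x s ⬝ᵥ y t) * (x s ⬝ᵥ deriv y t)) / (x s ⬝ᵥ y t - 1) ^ 2) s := by
    intro s t
    have hxs : HasDerivAt x (deriv x s) s := (hx.differentiable one_ne_zero s).hasDerivAt
    refine ((hasDerivAt_dotProduct_const hxs (deriv y t)).fun_div
      ((hasDerivAt_dotProduct_const hxs (y t)).sub_const 1) (hne s t)).congr_deriv ?_
    rw [mul_comm (x s ⬝ᵥ deriv y t)]
  have hint : MeasureTheory.IntegrableOn (Function.uncurry fun s t =>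
      ((deriv x s ⬝ᵥ deriv y t) * (x s ⬝ᵥ y t - 1)
        - (deriv x s ⬝ᵥ y t) * (x s ⬝ᵥ deriv y t)) / (x s ⬝ᵥ y t - 1) ^ 2)
      (Set.uIoc 0 L₁ ×ˢ Set.uIoc 0 L₂) :=
    (hcont.continuousOn.integrableOn_compact (isCompact_uIcc.prod isCompact_uIcc)).mono_set
      (Set.prod_mono Set.uIoc_subset_uIcc Set.uIoc_subset_uIcc)
  rw [MeasureTheory.intervalIntegral_intervalIntegral_swap hint]
  have hzero : ∀ t, (∫ s in (0:ℝ)..L₁,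
      ((deriv x s ⬝ᵥ deriv y t) * (x s ⬝ᵥ y t - 1)
        - (deriv x s ⬝ᵥ y t) * (x s ⬝ᵥ deriv y t)) / (x s ⬝ᵥ y t - 1) ^ 2) = 0 := by
    intro t
    have hcont_t := hcont.comp (Continuous.prodMk_left t)
    rw [integral_eq_sub_of_hasDerivAt (fun s _ => hderiv s t)
      (hcont_t.intervalIntegrable 0 L₁)]
    have hclosed : x L₁ = x 0 := by simpa using hperx 0
    simp only [hclosed, sub_self]
  simp only [hzero, integral_zero]
end

section
/- Let x, y : ℝ → S³ ⊂ ℝ⁴ be C¹ curves with x(s) ≠ y(t) for all s, t, and let σ(s,t) = P(x̄(s), ȳ(t)) / (1 − x(s)·y(t)) ∈ ℝ¹⁰. If x(s₀) = −y(t₀) (the two points are antipodal), then Q(∂σ/∂s, ∂σ/∂t)(s₀,t₀) = −(1/2)·x'(s₀)·y'(t₀). -/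
open Matrix

/-- Index set for the 10 Plücker coordinates: pairs `0 ≤ i < j ≤ 4`. -/
abbrev PIdx : Type := {p : Fin 5 × Fin 5 // p.1 < p.2}

/-- The Plücker vector of a pair of vectors in ℝ⁵. -/
noncomputable def Pl (u v : Fin 5 → ℝ) : PIdx → ℝ :=
  fun I => u I.1.1 * v I.1.2 - u I.1.2 * v I.1.1

/-- The indefinite inner product of signature (4,6) on `Λ²ℝ⁵₁ ≅ ℝ¹⁰`. -/
noncomputable def Q (z w : PIdx → ℝ) : ℝ :=
  ∑ I : PIdx, (if I.1.1 = 0 then (1:ℝ) else -1) * z I * w I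

/-- The lightlike lift `x̄ = (1, x) ∈ ℝ⁵` of a point of `S³ ⊂ ℝ⁴`. -/
noncomputable def lift (x : Fin 4 → ℝ) : Fin 5 → ℝ := Fin.cons 1 x

theorem Q_Pl_Pl (u v a b : Fin 5 → ℝ) :
    Q (Pl u v) (Pl a b) =
      (u ⬝ᵥ b - 2 * u 0 * b 0) * (v ⬝ᵥ a - 2 * v 0 * a 0)
        - (u ⬝ᵥ a - 2 * u 0 * a 0) * (v ⬝ᵥ b - 2 * v 0 * b 0) := by
  let F : Fin 5 × Fin 5 → ℝ := fun p =>
    (if p.1 = 0 then (1 : ℝ) else -1) * (u p.1 * v p.2 - u p.2 * v p.1)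
      * (a p.1 * b p.2 - a p.2 * b p.1)
  have h : Q (Pl u v) (Pl a b) = ∑ p : Fin 5 × Fin 5, if p.1 < p.2 then F p else 0 := by
    rw [← Finset.sum_filter]
    exact (Finset.sum_subtype _ (by simp) F).symm
  rw [h, Fintype.sum_prod_type]
  simp [F, Fin.sum_univ_five, dotProduct]
  ring

theorem Q_smul_smul (c d : ℝ) (z w : PIdx → ℝ) : Q (c • z) (d • w) = c * d * Q z w := by
  simp only [Q, Finset.mul_sum, Pi.smul_apply, smul_eq_mul]
  exact Finset.sum_congr rfl fun _ _ => by ring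

theorem lift_dotProduct_lift (x y : Fin 4 → ℝ) : lift x ⬝ᵥ lift y = 1 + x ⬝ᵥ y := by
  simp [lift, dotProduct, Fin.sum_univ_succ]

theorem cons_zero_dotProduct_lift (x y : Fin 4 → ℝ) :
    (Fin.cons 0 x : Fin 5 → ℝ) ⬝ᵥ lift y = x ⬝ᵥ y := by
  simp [lift, dotProduct, Fin.sum_univ_succ]

theorem cons_zero_dotProduct_cons_zero (x y : Fin 4 → ℝ) :
    (Fin.cons 0 x : Fin 5 → ℝ) ⬝ᵥ (Fin.cons 0 y : Fin 5 → ℝ) = x ⬝ᵥ y := by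
  simp [dotProduct, Fin.sum_univ_succ]

theorem HasDerivAt.lift {x : ℝ → Fin 4 → ℝ} {x' : Fin 4 → ℝ} {s : ℝ}
    (hx : HasDerivAt x x' s) :
    HasDerivAt (fun a => _root_.lift (x a)) (Fin.cons 0 x' : Fin 5 → ℝ) s := by
  rw [hasDerivAt_pi] at hx ⊢
  intro i
  refine Fin.cases ?_ (fun j => ?_) i
  · simpa [_root_.lift] using hasDerivAt_const s (1 : ℝ)
  · simpa [_root_.lift] using hx j

theorem HasDerivAt.dotProduct {n : Type*} [Fintype n] {x y : ℝ → n → ℝ} {x' y' : n → ℝ} {s : ℝ}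
    (hx : HasDerivAt x x' s) (hy : HasDerivAt y y' s) :
    HasDerivAt (fun a => x a ⬝ᵥ y a) (x' ⬝ᵥ y s + x s ⬝ᵥ y') s := by
  rw [hasDerivAt_pi] at hx hy
  simp only [_root_.dotProduct, ← Finset.sum_add_distrib]
  exact HasDerivAt.fun_sum fun i _ => (hx i).mul (hy i)

/-- A differentiable curve in the unit sphere is orthogonal to its velocity. -/
theorem dotProduct_eq_zero_of_hasDerivAt {n : Type*} [Fintype n] {x : ℝ → n → ℝ} {x' : n → ℝ}
    {s : ℝ} (hx : HasDerivAt x x' s) (hS : ∀ a, x a ⬝ᵥ x a = 1) : x' ⬝ᵥ x s = 0 := by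
  have h := hx.dotProduct hx
  simp only [hS] at h
  have h0 := h.unique (hasDerivAt_const s (1 : ℝ))
  rw [dotProduct_comm (x s) x'] at h0
  linarith

/-- Derivative of the normalized Plücker vector when the normalization is stationary. -/
theorem HasDerivAt.inv_smul_Pl {x : ℝ → Fin 4 → ℝ} {x' y : Fin 4 → ℝ} {s : ℝ}
    (hx : HasDerivAt x x' s) (h0 : x' ⬝ᵥ y = 0) (h1 : 1 - x s ⬝ᵥ y ≠ 0) :
    HasDerivAt (fun a => (1 - x a ⬝ᵥ y)⁻¹ • Pl (_root_.lift (x a)) (_root_.lift y))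
      ((1 - x s ⬝ᵥ y)⁻¹ • Pl (Fin.cons 0 x') (_root_.lift y)) s := by
  have hc : HasDerivAt (fun a => (1 - x a ⬝ᵥ y)⁻¹) 0 s := by
    have h := ((hx.dotProduct (hasDerivAt_const s y)).const_sub 1).fun_inv h1
    simpa [h0] using h
  have hP : HasDerivAt (fun a => Pl (_root_.lift (x a)) (_root_.lift y))
      (Pl (Fin.cons 0 x') (_root_.lift y)) s := by
    have hl := hasDerivAt_pi.1 hx.lift
    exact hasDerivAt_pi.2 fun I => ((hl _).mul_const _).sub ((hl _).mul_const _)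
  simpa using hc.fun_smul hP

theorem Pl_swap (u v : Fin 5 → ℝ) : Pl u v = -Pl v u := by
  ext I
  simp [Pl]
  ring

/-- at a pair of antipodal points `x(s₀) = −y(t₀)`, the mixed Gram entry of the
torus parametrization `σ(s,t) = P(x̄(s), ȳ(t))/(1 − x(s)·y(t))` is
`Q(σ_s, σ_t)(s₀,t₀) = −(1/2)·x'(s₀)·y'(t₀)`. -/
theorem gram_entry_at_antipodal_points
    (x y : ℝ → (Fin 4 → ℝ))
    (hx : ContDiff ℝ 1 x) (hy : ContDiff ℝ 1 y)
    (hxS : ∀ s, x s ⬝ᵥ x s = 1) (hyS : ∀ t, y t ⬝ᵥ y t = 1)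
    (hdisj : ∀ s t, x s ≠ y t)
    (σ : ℝ → ℝ → (PIdx → ℝ))
    (hσ : ∀ s t, σ s t = (1 - x s ⬝ᵥ y t)⁻¹ • Pl (lift (x s)) (lift (y t)))
    (s₀ t₀ : ℝ) (hanti : x s₀ = -y t₀) :
    Q (deriv (fun a => σ a t₀) s₀) (deriv (fun b => σ s₀ b) t₀)
      = -(1/2) * (deriv x s₀ ⬝ᵥ deriv y t₀) := by
  have hx' := (hx.differentiable one_ne_zero s₀).hasDerivAt
  have hy' := (hy.differentiable one_ne_zero t₀).hasDerivAt
  have hxx := dotProduct_eq_zero_of_hasDerivAt hx' hxS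
  have hyy := dotProduct_eq_zero_of_hasDerivAt hy' hyS
  have hxy : deriv x s₀ ⬝ᵥ y t₀ = 0 := by simpa [hanti] using hxx
  have hyx : deriv y t₀ ⬝ᵥ x s₀ = 0 := by simpa [hanti] using hyy
  have hc : x s₀ ⬝ᵥ y t₀ = -1 := by simp [hanti, hyS]
  have hc' : y t₀ ⬝ᵥ x s₀ = -1 := by rw [dotProduct_comm, hc]
  have hs := hx'.inv_smul_Pl hxy (by rw [hc]; norm_num)
  have ht := (hy'.inv_smul_Pl hyx (by rw [hc']; norm_num)).fun_neg
  have es : (fun a => σ a t₀) = fun a => (1 - x a ⬝ᵥ y t₀)⁻¹ • Pl (lift (x a)) (lift (y t₀)) :=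
    funext fun a => hσ a t₀
  have et : (fun b => σ s₀ b) =
      fun b => -((1 - y b ⬝ᵥ x s₀)⁻¹ • Pl (lift (y b)) (lift (x s₀))) := by
    funext b
    rw [hσ, Pl_swap, smul_neg, dotProduct_comm]
  rw [es, et, hs.deriv, ht.deriv, ← smul_neg, ← Pl_swap, Q_smul_smul, Q_Pl_Pl,
    cons_zero_dotProduct_cons_zero, cons_zero_dotProduct_lift, lift_dotProduct_lift, hxx, hc, hc']
  simp only [Fin.cons_zero, lift]
  ring
end

section
/- If A ∈ M₅(ℝ) satisfies Aᵀ η A = η, where η = diag(−1, 1, 1, 1, 1) (i.e. A is a pseudo-orthogonal transformation of Minkowski space ℝ⁵₁, A ∈ O(4,1)), then Ψ(A)ᵀ η̃ Ψ(A) = η̃, i.e. Ψ(A) ∈ O(4,6). -/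
open Matrix

/-- The second compound matrix `Ψ(A)` of a 5×5 matrix `A`. -/
noncomputable def Psi (A : Matrix (Fin 5) (Fin 5) ℝ) : Matrix PIdx PIdx ℝ :=
  fun I J => A I.1.1 J.1.1 * A I.1.2 J.1.2 - A I.1.1 J.1.2 * A I.1.2 J.1.1

/-- The Gram matrix `η = diag(−1,1,1,1,1)` of the Minkowski form on ℝ⁵. -/
noncomputable def eta : Matrix (Fin 5) (Fin 5) ℝ :=
  Matrix.diagonal ![-1, 1, 1, 1, 1]

/-- The Gram matrix `η̃` of the induced form of signature (4,6) on `Λ²ℝ⁵₁ ≅ ℝ¹⁰`: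
diagonal, with entry `+1` at `(i₁,i₂)` if `i₁ = 0` and `−1` if `i₁ ≥ 1`. -/
noncomputable def etaTilde : Matrix PIdx PIdx ℝ :=
  Matrix.diagonal fun I => if I.1.1 = 0 then (1:ℝ) else -1

theorem PIdx.sum_eq (f : Fin 5 → Fin 5 → ℝ) :
    ∑ K : PIdx, f K.1.1 K.1.2 = ∑ k, ∑ l, if k < l then f k l else 0 := by
  rw [← Fintype.sum_prod_type' (f := fun k l => if k < l then f k l else 0),
    ← Finset.sum_filter]
  exact (Finset.sum_subtype _ (by simp) fun p : Fin 5 × Fin 5 => f p.1 p.2).symm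

/-- The Cauchy–Binet formula for second compound matrices. -/
theorem Psi_mul (A B : Matrix (Fin 5) (Fin 5) ℝ) : Psi (A * B) = Psi A * Psi B := by
  ext ⟨⟨i, j⟩, _⟩ ⟨⟨p, q⟩, _⟩
  rw [Matrix.mul_apply]
  simp only [Psi]
  rw [PIdx.sum_eq fun k l => (A i k * A j l - A i l * A j k) * (B k p * B l q - B k q * B l p)]
  simp only [Matrix.mul_apply, Fin.sum_univ_five, Fin.reduceLT, if_true, if_false, lt_irrefl]
  ring

theorem Psi_transpose (A : Matrix (Fin 5) (Fin 5) ℝ) : Psi Aᵀ = (Psi A)ᵀ := by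
  ext I J
  simp only [Psi, Matrix.transpose_apply]
  ring

theorem etaTilde_eq_neg_Psi_eta : etaTilde = -Psi eta := by
  ext ⟨⟨i, j⟩, hij⟩ ⟨⟨p, q⟩, hpq⟩
  fin_cases i <;> fin_cases j <;> first | (exact absurd hij (by decide)) | skip
  all_goals
    fin_cases p <;> fin_cases q <;> first
      | (exact absurd hpq (by decide))
      | simp [etaTilde, Psi, eta]

/-- if `A ∈ O(4,1)`, i.e. `Aᵀ η A = η`, then `Ψ(A) ∈ O(4,6)`,
i.e. `Ψ(A)ᵀ η̃ Ψ(A) = η̃`. -/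
theorem compound_of_pseudo_orthogonal_is_pseudo_orthogonal
    (A : Matrix (Fin 5) (Fin 5) ℝ) (hA : Aᵀ * eta * A = eta) :
    (Psi A)ᵀ * etaTilde * Psi A = etaTilde := by
  rw [etaTilde_eq_neg_Psi_eta, Matrix.mul_neg, Matrix.neg_mul, ← Psi_transpose, ← Psi_mul,
    ← Psi_mul, hA]
end

section
/- Let A ∈ M₅(ℝ) satisfy Aᵀ η A = η with η = diag(−1,1,1,1,1), and let u, v ∈ ℝ⁵ be lightlike vectors (B(u,u) = B(v,v) = 0) with B(u,v) ≠ 0. Then Q(P(u,v), P(u,v)) = B(u,v)² > 0, Q(P(Au,Av), P(Au,Av)) > 0, and the normalized Plücker vectors are equivariant: Ψ(A)·( P(u,v) / √Q(P(u,v),P(u,v)) ) = P(Au, Av) / √Q(P(Au,Av), P(Au,Av)). (That is, ψ(A·Σ) = Ψ(A)·ψ(Σ) for every oriented 0-sphere Σ in S³.) -/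
open Matrix

/-- The Minkowski bilinear form on ℝ⁵. -/
noncomputable def MinkB (u v : Fin 5 → ℝ) : ℝ :=
  -(u 0 * v 0) + u 1 * v 1 + u 2 * v 2 + u 3 * v 3 + u 4 * v 4

theorem sum_PIdx (f : Fin 5 → Fin 5 → ℝ) :
    ∑ I : PIdx, f I.1.1 I.1.2 = ∑ i, ∑ j, if i < j then f i j else 0 := by
  rw [← Fintype.sum_prod_type' (fun i j => if i < j then f i j else 0), ← Finset.sum_filter]
  exact (Finset.sum_subtype (p := fun p : Fin 5 × Fin 5 => p.1 < p.2) _ (by simp)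
    (fun p => f p.1 p.2)).symm

/-- The Lagrange identity for the Minkowski form. -/
theorem Q_Pl_self (u v : Fin 5 → ℝ) :
    Q (Pl u v) (Pl u v) = MinkB u v ^ 2 - MinkB u u * MinkB v v := by
  unfold Q Pl MinkB
  rw [sum_PIdx (fun i j => (if i = 0 then (1 : ℝ) else -1) *
    (u i * v j - u j * v i) * (u i * v j - u j * v i))]
  simp [Fin.sum_univ_five]
  ring

theorem MinkB_eq_dotProduct (u v : Fin 5 → ℝ) : MinkB u v = u ⬝ᵥ eta *ᵥ v := by
  simp [MinkB, eta, dotProduct, Matrix.mulVec_diagonal, Fin.sum_univ_five]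

/-- Lorentz transformations preserve the Minkowski form. -/
theorem MinkB_mulVec {A : Matrix (Fin 5) (Fin 5) ℝ} (hA : Aᵀ * eta * A = eta)
    (u v : Fin 5 → ℝ) : MinkB (A *ᵥ u) (A *ᵥ v) = MinkB u v := by
  rw [MinkB_eq_dotProduct, MinkB_eq_dotProduct, ← Matrix.vecMul_transpose,
    ← Matrix.dotProduct_mulVec, Matrix.mulVec_mulVec, Matrix.mulVec_mulVec, hA]

/-- The second compound matrix acts on Plücker vectors (Cauchy–Binet). -/
theorem Psi_mulVec_Pl (A : Matrix (Fin 5) (Fin 5) ℝ) (u v : Fin 5 → ℝ) :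
    Psi A *ᵥ Pl u v = Pl (A *ᵥ u) (A *ᵥ v) := by
  funext I
  obtain ⟨⟨a, b⟩, h⟩ := I
  simp only [Matrix.mulVec, dotProduct, Psi, Pl]
  rw [sum_PIdx (fun i j => (A a i * A b j - A a j * A b i) * (u i * v j - u j * v i))]
  simp [Fin.sum_univ_five]
  ring

/-- for `A ∈ O(4,1)` and lightlike `u, v` with `B(u,v) ≠ 0`, the normalized
Plücker vectors of timelike planes are equivariant under `Ψ(A)`:
`ψ(A·Σ) = Ψ(A)·ψ(Σ)` for every oriented 0-sphere `Σ` in `S³`. -/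
theorem normalized_pluecker_equivariant
    (A : Matrix (Fin 5) (Fin 5) ℝ) (hA : Aᵀ * eta * A = eta)
    (u v : Fin 5 → ℝ) (hu : MinkB u u = 0) (hv : MinkB v v = 0) (huv : MinkB u v ≠ 0) :
    Q (Pl u v) (Pl u v) = MinkB u v ^ 2 ∧
    0 < Q (Pl u v) (Pl u v) ∧
    0 < Q (Pl (A.mulVec u) (A.mulVec v)) (Pl (A.mulVec u) (A.mulVec v)) ∧
    (Psi A).mulVec ((Real.sqrt (Q (Pl u v) (Pl u v)))⁻¹ • Pl u v)
      = (Real.sqrt (Q (Pl (A.mulVec u) (A.mulVec v)) (Pl (A.mulVec u) (A.mulVec v))))⁻¹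
          • Pl (A.mulVec u) (A.mulVec v) := by
  have hQ : Q (Pl u v) (Pl u v) = MinkB u v ^ 2 := by simp [Q_Pl_self, hu]
  have hQA : Q (Pl (A *ᵥ u) (A *ᵥ v)) (Pl (A *ᵥ u) (A *ᵥ v)) = MinkB u v ^ 2 := by
    simp [Q_Pl_self, MinkB_mulVec hA, hu]
  have hpos : 0 < MinkB u v ^ 2 := by positivity
  refine ⟨hQ, hQ ▸ hpos, hQA ▸ hpos, ?_⟩
  rw [hQ, hQA, Matrix.mulVec_smul, Psi_mulVec_Pl]
end

section
/- Let w = P(e₀, e₁) ∈ ℝ¹⁰ (the Plücker vector of the timelike plane span{e₀, e₁}, a point of Θ(0,3)). The tangent space of Θ(0,3) at w — namely the set of z ∈ ℝ¹⁰ annihilated by the differential at w of the norm function v ↦ Q(v,v) and by the differentials at w of the five Plücker quadrics v ↦ v_{ij}v_{kl} − v_{ik}v_{jl} + v_{il}v_{jk} (0 ≤ i < j < k < l ≤ 4) — equals the 6-dimensional subspace V spanned by the standard basis vectors of ℝ¹⁰ at indices (0,2), (0,3), (0,4), (1,2), (1,3), (1,4), and the restriction of Q to V is nondegenerate of signature (3,3),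 i.e. of index 3. -/
open Matrix

/-- The Plücker quadric associated with indices `i < j < k < l`:
`v ↦ v_{ij}v_{kl} − v_{ik}v_{jl} + v_{il}v_{jk}`. -/
noncomputable def plueckerQuadric (i j k l : Fin 5)
    (hij : i < j) (hjk : j < k) (hkl : k < l) (v : PIdx → ℝ) : ℝ :=
  v ⟨(i, j), hij⟩ * v ⟨(k, l), hkl⟩
    - v ⟨(i, k), hij.trans hjk⟩ * v ⟨(j, l), hjk.trans hkl⟩
    + v ⟨(i, l), (hij.trans hjk).trans hkl⟩ * v ⟨(j, k), hjk⟩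

/-- The Plücker indices `(0,2), (0,3), (0,4), (1,2), (1,3), (1,4)`. -/
def tangentIdx : Fin 6 → PIdx :=
  ![⟨(0, 2), by decide⟩, ⟨(0, 3), by decide⟩, ⟨(0, 4), by decide⟩,
    ⟨(1, 2), by decide⟩, ⟨(1, 3), by decide⟩, ⟨(1, 4), by decide⟩]

lemma tangentIdx_injective : Function.Injective tangentIdx := by decide

lemma mem_range_tangentIdx (I : PIdx) :
    I ∈ Set.range tangentIdx ↔ I.1.1 < 2 ∧ 2 ≤ I.1.2 := by
  rw [Set.mem_range]
  revert I
  decide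

lemma mem_span_range_single {ι κ : Type*} [Fintype ι] [DecidableEq ι] (f : κ → ι) (z : ι → ℝ) :
    z ∈ Submodule.span ℝ (Set.range fun k => (Pi.single (f k) 1 : ι → ℝ)) ↔
      ∀ i ∉ Set.range f, z i = 0 := by
  have h : (Set.range fun k => (Pi.single (f k) 1 : ι → ℝ)) =
      Pi.basisFun ℝ ι '' Set.range f := by
    rw [← Set.range_comp]
    congr 1
    ext k : 1
    simp
  rw [h, Module.Basis.mem_span_image]
  simp only [Set.subset_def, Finset.mem_coe, Finsupp.mem_support_iff, Pi.basisFun_repr]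
  exact forall_congr' fun i => not_imp_comm

lemma Q_single_left (I : PIdx) (z : PIdx → ℝ) :
    Q (Pi.single I 1) z = (if I.1.1 = 0 then (1 : ℝ) else -1) * z I := by
  rw [Q, Finset.sum_eq_single I]
  · simp
  · intro K _ hK
    simp [hK]
  · simp

lemma Q_single_single (I J : PIdx) :
    Q (Pi.single I 1) (Pi.single J 1) =
      if I = J then (if I.1.1 = 0 then (1 : ℝ) else -1) else 0 := by
  rw [Q_single_left, Pi.single_apply, mul_ite, mul_one, mul_zero]

lemma Pl_single_zero_one :
    Pl (Pi.single 0 1) (Pi.single 1 1) = Pi.single ⟨(0, 1), by decide⟩ 1 := by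
  ext ⟨⟨i, j⟩, h⟩
  fin_cases i <;> fin_cases j <;> first | exact absurd h (by decide) | simp [Pl]

lemma hasFDerivAt_coord_mul (w : PIdx → ℝ) (I J : PIdx) :
    HasFDerivAt (fun v : PIdx → ℝ => v I * v J)
      (w I • ContinuousLinearMap.proj (R := ℝ) (φ := fun _ : PIdx => ℝ) J +
        w J • ContinuousLinearMap.proj (R := ℝ) (φ := fun _ : PIdx => ℝ) I) w :=
  (hasFDerivAt_apply I w).mul (hasFDerivAt_apply J w)

lemma fderiv_Q_apply (w z : PIdx → ℝ) : fderiv ℝ (fun v => Q v v) w z = 2 * Q w z := by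
  have h := HasFDerivAt.fun_sum (u := Finset.univ) fun (I : PIdx) _ =>
    (hasFDerivAt_coord_mul w I I).const_mul (if I.1.1 = 0 then (1 : ℝ) else -1)
  simp only [← mul_assoc] at h
  change HasFDerivAt (fun v => Q v v) _ w at h
  rw [h.fderiv]
  simp only [Q, _root_.sum_apply, Finset.mul_sum]
  refine Finset.sum_congr rfl fun I _ => ?_
  split_ifs <;> simp <;> ring

lemma fderiv_plueckerQuadric_apply (i j k l : Fin 5) (hij : i < j) (hjk : j < k) (hkl : k < l)
    (w z : PIdx → ℝ) :
    fderiv ℝ (plueckerQuadric i j k l hij hjk hkl) w z =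
      w ⟨(i, j), hij⟩ * z ⟨(k, l), hkl⟩ + w ⟨(k, l), hkl⟩ * z ⟨(i, j), hij⟩
      - (w ⟨(i, k), hij.trans hjk⟩ * z ⟨(j, l), hjk.trans hkl⟩
        + w ⟨(j, l), hjk.trans hkl⟩ * z ⟨(i, k), hij.trans hjk⟩)
      + (w ⟨(i, l), (hij.trans hjk).trans hkl⟩ * z ⟨(j, k), hjk⟩
        + w ⟨(j, k), hjk⟩ * z ⟨(i, l), (hij.trans hjk).trans hkl⟩) := by
  have h : HasFDerivAt (plueckerQuadric i j k l hij hjk hkl) _ w :=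
    ((hasFDerivAt_coord_mul w ⟨(i, j), hij⟩ ⟨(k, l), hkl⟩).sub
      (hasFDerivAt_coord_mul w ⟨(i, k), hij.trans hjk⟩ ⟨(j, l), hjk.trans hkl⟩)).add
      (hasFDerivAt_coord_mul w ⟨(i, l), (hij.trans hjk).trans hkl⟩ ⟨(j, k), hjk⟩)
  rw [h.fderiv]
  simp

/-- at the point `w = P(e₀,e₁)` of `Θ(0,3)`, the tangent space — the common
kernel of the differentials of the norm function and of the five Plücker quadrics — is the
6-dimensional coordinate subspace spanned by the standard basis vectors at the indices
`(0,2), (0,3), (0,4), (1,2), (1,3), (1,4)`, on which `Q` restricts to a nondegenerate form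
of signature (3,3), i.e. of index 3. -/
theorem tangent_space_at_basepoint_and_index
    (w : PIdx → ℝ) (hw : w = Pl (Pi.single 0 1) (Pi.single 1 1))
    (V : Submodule ℝ (PIdx → ℝ))
    (hV : V = Submodule.span ℝ
      ({Pi.single ⟨(0, 2), by decide⟩ 1, Pi.single ⟨(0, 3), by decide⟩ 1,
        Pi.single ⟨(0, 4), by decide⟩ 1, Pi.single ⟨(1, 2), by decide⟩ 1,
        Pi.single ⟨(1, 3), by decide⟩ 1, Pi.single ⟨(1, 4), by decide⟩ 1} :
        Set (PIdx → ℝ))) :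
    {z : PIdx → ℝ |
        fderiv ℝ (fun v => Q v v) w z = 0 ∧
        ∀ (i j k l : Fin 5) (hij : i < j) (hjk : j < k) (hkl : k < l),
          fderiv ℝ (plueckerQuadric i j k l hij hjk hkl) w z = 0}
      = (V : Set (PIdx → ℝ)) ∧
    ∃ b : Fin 6 → (PIdx → ℝ),
      (∀ i, b i ∈ V) ∧
      LinearIndependent ℝ b ∧
      Submodule.span ℝ (Set.range b) = V ∧
      (∀ i j, Q (b i) (b j) =
        if i = j then (if (i : ℕ) < 3 then (1:ℝ) else -1) else 0) := by
  have hspan : V = Submodule.span ℝ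
      (Set.range fun i => (Pi.single (tangentIdx i) 1 : PIdx → ℝ)) := by
    rw [hV]
    congr 1
    ext z
    simp [Fin.exists_fin_succ, tangentIdx, eq_comm]
  rw [Pl_single_zero_one] at hw
  refine ⟨?_, fun i => Pi.single (tangentIdx i) 1, ?_, ?_, hspan.symm, ?_⟩
  · ext z
    rw [SetLike.mem_coe, hspan, mem_span_range_single]
    simp only [Set.mem_ofPred_eq, fderiv_Q_apply, fderiv_plueckerQuadric_apply, hw, Q_single_left,
      mem_range_tangentIdx]
    constructor
    · rintro ⟨hQ, hP⟩ ⟨⟨i, j⟩, hij⟩ hI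
      by_cases hi : 2 ≤ i
      · have h := hP 0 1 i j (by decide) (lt_of_lt_of_le (by decide) hi) hij
        have hi0 : i ≠ 0 := by rintro rfl; exact absurd hi (by decide)
        have hi1 : i ≠ 1 := by rintro rfl; exact absurd hi (by decide)
        have hj1 : j ≠ 1 := by
          rintro rfl
          exact absurd (hi.trans_lt hij : (2 : Fin 5) < 1) (by decide)
        simpa [Pi.single_apply, hi0, hi1, hj1] using h
      · obtain ⟨rfl, rfl⟩ : i = 0 ∧ j = 1 := by
          simp only at hij hI
          revert i j
          decide
        simpa using hQ
    · intro h
      refine ⟨by simp [h ⟨(0, 1), by decide⟩ (by decide)], fun i j k l hij hjk hkl => ?_⟩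
      have hj : j ≠ 0 := (Fin.zero_le i |>.trans_lt hij).ne'
      have hk : k ≠ 0 := (Fin.zero_le j |>.trans_lt hjk).ne'
      have hk1 : k ≠ 1 := by
        rintro rfl
        exact hj (by omega)
      have hl1 : l ≠ 1 := by
        rintro rfl
        exact hk (by omega)
      have hkl2 : z ⟨(k, l), hkl⟩ = 0 := h _ fun h' => absurd h'.1 (by simp only; omega)
      simp [Pi.single_apply, hj, hk, hk1, hl1, hkl2]
  · intro i
    rw [hspan]
    exact Submodule.subset_span ⟨i, rfl⟩
  · simpa [Function.comp_def] using
      (Pi.basisFun ℝ PIdx).linearIndependent.comp tangentIdx tangentIdx_injective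
  · intro i j
    have hsign : (tangentIdx i).1.1 = 0 ↔ (i : ℕ) < 3 := by
      revert i
      decide
    simp only [Q_single_single, tangentIdx_injective.eq_iff, hsign]
end

section
/- Let x, y ∈ S³ ⊂ ℝ⁴ with x ≠ y, and let u, v ∈ ℝ⁴ satisfy u·x = 0 and v·y = 0 (tangent vectors at x and y). Then |(1 − x·y)(u·v) + (u·y)(x·v)| ≤ (1 − x·y)·|u|·|v|. Equivalently, the signed area density is bounded by the absolute value of the infinitesimal cross ratio: |((u·v)(x·y − 1) − (u·y)(x·v)) / (x·y − 1)²| ≤ 2|u||v| / |x − y|². -/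
open Matrix

/-- Cauchy–Schwarz for the real dot product. -/
theorem abs_dotProduct_le_sqrt_mul_sqrt {n : Type*} [Fintype n] (a b : n → ℝ) :
    |a ⬝ᵥ b| ≤ Real.sqrt (a ⬝ᵥ a) * Real.sqrt (b ⬝ᵥ b) := by
  have ha : 0 ≤ a ⬝ᵥ a := Finset.sum_nonneg fun i _ => mul_self_nonneg (a i)
  rw [← Real.sqrt_mul ha]
  apply Real.abs_le_sqrt
  simpa only [dotProduct, sq] using Finset.sum_mul_sq_le_sq_mul_sq Finset.univ a b

/-- The squared chord length between two unit vectors. -/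
theorem sub_dotProduct_sub_of_unit {n : Type*} [Fintype n] {x y : n → ℝ}
    (hx : x ⬝ᵥ x = 1) (hy : y ⬝ᵥ y = 1) :
    (x - y) ⬝ᵥ (x - y) = 2 * (1 - x ⬝ᵥ y) := by
  simp only [sub_dotProduct, dotProduct_sub, hx, hy, dotProduct_comm y x]
  ring

theorem one_sub_dotProduct_pos_of_unit_of_ne {n : Type*} [Fintype n] {x y : n → ℝ}
    (hx : x ⬝ᵥ x = 1) (hy : y ⬝ᵥ y = 1) (hxy : x ≠ y) : 0 < 1 - x ⬝ᵥ y := by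
  have h0 : 0 ≤ (x - y) ⬝ᵥ (x - y) := Finset.sum_nonneg fun i _ => mul_self_nonneg ((x - y) i)
  have hne : (x - y) ⬝ᵥ (x - y) ≠ 0 := fun h => hxy (sub_eq_zero.1 (dotProduct_self_eq_zero.1 h))
  have := sub_dotProduct_sub_of_unit hx hy
  have := lt_of_le_of_ne h0 hne.symm
  linarith

/-- The vector `(1 - x·y) u + (u·y) (x - y)` is `1 - x·y` times the reflection of `u` in the
hyperplane orthogonal to `x - y`, so the bound is Cauchy–Schwarz for it and `v`. -/
theorem abs_one_sub_dotProduct_mul_add_le {n : Type*} [Fintype n] {x y u v : n → ℝ}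
    (hx : x ⬝ᵥ x = 1) (hy : y ⬝ᵥ y = 1) (hxy : x ≠ y) (hu : u ⬝ᵥ x = 0) (hv : v ⬝ᵥ y = 0) :
    |(1 - x ⬝ᵥ y) * (u ⬝ᵥ v) + (u ⬝ᵥ y) * (x ⬝ᵥ v)|
      ≤ (1 - x ⬝ᵥ y) * Real.sqrt (u ⬝ᵥ u) * Real.sqrt (v ⬝ᵥ v) := by
  have hd := one_sub_dotProduct_pos_of_unit_of_ne hx hy hxy
  set w : n → ℝ := (1 - x ⬝ᵥ y) • u + (u ⬝ᵥ y) • (x - y) with hw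
  have hwv : w ⬝ᵥ v = (1 - x ⬝ᵥ y) * (u ⬝ᵥ v) + (u ⬝ᵥ y) * (x ⬝ᵥ v) := by
    simp only [hw, add_dotProduct, smul_dotProduct, sub_dotProduct, smul_eq_mul,
      dotProduct_comm y v, hv, sub_zero]
  have hww : w ⬝ᵥ w = (1 - x ⬝ᵥ y) ^ 2 * (u ⬝ᵥ u) := by
    simp only [hw, add_dotProduct, dotProduct_add, smul_dotProduct, dotProduct_smul,
      sub_dotProduct, dotProduct_sub, smul_eq_mul, dotProduct_comm x u, dotProduct_comm y u,
      dotProduct_comm y x, hx, hy, hu]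
    ring
  have h := abs_dotProduct_le_sqrt_mul_sqrt w v
  rwa [hwv, hww, Real.sqrt_mul (sq_nonneg _), Real.sqrt_sq hd.le] at h

/-- for `x ≠ y` on `S³` and tangent vectors `u ⊥ x`, `v ⊥ y`,
`|(1 − x·y)(u·v) + (u·y)(x·v)| ≤ (1 − x·y)|u||v|`; equivalently, the signed area density is
bounded by the modulus of the infinitesimal cross ratio
(`|Re Ω| ≤ |Ω|`, i.e. `|cos θ| ≤ 1` for the conformal angle `θ`). -/
theorem signed_area_density_le_infinitesimal_cross_ratio
    (x y u v : Fin 4 → ℝ)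
    (hxS : x ⬝ᵥ x = 1) (hyS : y ⬝ᵥ y = 1) (hxy : x ≠ y)
    (hu : u ⬝ᵥ x = 0) (hv : v ⬝ᵥ y = 0) :
    |(1 - x ⬝ᵥ y) * (u ⬝ᵥ v) + (u ⬝ᵥ y) * (x ⬝ᵥ v)|
        ≤ (1 - x ⬝ᵥ y) * Real.sqrt (u ⬝ᵥ u) * Real.sqrt (v ⬝ᵥ v) ∧
    |((u ⬝ᵥ v) * (x ⬝ᵥ y - 1) - (u ⬝ᵥ y) * (x ⬝ᵥ v)) / (x ⬝ᵥ y - 1) ^ 2|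
        ≤ 2 * Real.sqrt (u ⬝ᵥ u) * Real.sqrt (v ⬝ᵥ v) / ((x - y) ⬝ᵥ (x - y)) := by
  have hd := one_sub_dotProduct_pos_of_unit_of_ne hxS hyS hxy
  have h := abs_one_sub_dotProduct_mul_add_le hxS hyS hxy hu hv
  refine ⟨h, ?_⟩
  have hnum : (u ⬝ᵥ v) * (x ⬝ᵥ y - 1) - (u ⬝ᵥ y) * (x ⬝ᵥ v)
      = -((1 - x ⬝ᵥ y) * (u ⬝ᵥ v) + (u ⬝ᵥ y) * (x ⬝ᵥ v)) := by ring
  have hden : (x ⬝ᵥ y - 1) ^ 2 = (1 - x ⬝ᵥ y) ^ 2 := by ring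
  rw [hnum, hden, abs_div, abs_neg, abs_of_pos (pow_pos hd 2),
    sub_dotProduct_sub_of_unit hxS hyS]
  calc _ ≤ (1 - x ⬝ᵥ y) * Real.sqrt (u ⬝ᵥ u) * Real.sqrt (v ⬝ᵥ v) / (1 - x ⬝ᵥ y) ^ 2 := by gcongr
    _ = _ := by
      have := hd.ne'
      field_simp
end

section
/- The map ψ : {(x, y) ∈ S³ × S³ : x ≠ y} → ℝ¹⁰ defined by ψ(x,y) = P(x̄, ȳ) / (1 − x·y) is a bijection onto Θ(0,3) = {v ∈ ℝ¹⁰ : Q(v,v) = 1 and v_{ij}v_{kl} − v_{ik}v_{jl} + v_{il}v_{jk} = 0 for all 0 ≤ i < j < k < l ≤ 4}. (In particular ψ is injective, Q(ψ(x,y), ψ(x,y)) = 1, and ψ(x,y) satisfies the Plücker relations, for all x ≠ y in S³.) -/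
open Matrix

/-- The set of pairs of distinct points of `S³`, i.e. of oriented 0-spheres in `S³`. -/
def spherePairs : Set ((Fin 4 → ℝ) × (Fin 4 → ℝ)) :=
  {p | p.1 ⬝ᵥ p.1 = 1 ∧ p.2 ⬝ᵥ p.2 = 1 ∧ p.1 ≠ p.2}

/-- `Θ(0,3)`: unit-norm vectors of `ℝ¹⁰` satisfying the Plücker relations. -/
def Theta03 : Set (PIdx → ℝ) :=
  {v | Q v v = 1 ∧
    ∀ (i j k l : Fin 5) (hij : i < j) (hjk : j < k) (hkl : k < l),
      v ⟨(i, j), hij⟩ * v ⟨(k, l), hkl⟩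
        - v ⟨(i, k), hij.trans hjk⟩ * v ⟨(j, l), hjk.trans hkl⟩
        + v ⟨(i, l), (hij.trans hjk).trans hkl⟩ * v ⟨(j, k), hjk⟩ = 0}

/-- The coordinates `v_{0j}`, `1 ≤ j ≤ 4`, of a vector of `ℝ¹⁰`. -/
def timePart (v : PIdx → ℝ) : Fin 4 → ℝ := fun j => v ⟨(0, j.succ), j.succ_pos⟩

/-- The coordinates `v_{ij}`, `1 ≤ i, j ≤ 4`, of a vector of `ℝ¹⁰`, extended
antisymmetrically. -/
def spacePart (v : PIdx → ℝ) : Matrix (Fin 4) (Fin 4) ℝ := fun i j =>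
  if h : i < j then v ⟨(i.succ, j.succ), Fin.succ_lt_succ_iff.2 h⟩
  else if h : j < i then -v ⟨(j.succ, i.succ), Fin.succ_lt_succ_iff.2 h⟩ else 0

lemma ext_timePart_spacePart {v w : PIdx → ℝ} (ht : timePart v = timePart w)
    (hs : spacePart v = spacePart w) : v = w := by
  funext ⟨⟨i, j⟩, hij⟩
  change i < j at hij
  obtain ⟨j, rfl⟩ := Fin.exists_succ_eq.2 (Fin.ne_zero_of_lt hij)
  rcases Fin.eq_zero_or_eq_succ i with rfl | ⟨i, rfl⟩
  · exact congrFun ht j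
  · have h := Fin.succ_lt_succ_iff.1 hij
    simpa [spacePart, h] using congrFun (congrFun hs i) j

lemma Q_self_eq (v : PIdx → ℝ) :
    Q v v = timePart v ⬝ᵥ timePart v - (∑ i, ∑ j, spacePart v i j ^ 2) / 2 := by
  have hsum (f : PIdx → ℝ) :
      ∑ I, f I = ∑ i : Fin 5, ∑ j : Fin 5, if h : i < j then f ⟨(i, j), h⟩ else 0 := by
    rw [← Fintype.sum_prod_type']
    refine Fintype.sum_of_injective Subtype.val Subtype.val_injective _ _ ?_ ?_
    · intro p hp
      exact dif_neg fun h => hp ⟨⟨p, h⟩, rfl⟩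
    · intro I
      simp [I.2]
  rw [Q, hsum]
  simp [Fin.sum_univ_succ, dotProduct, timePart, spacePart]
  ring

lemma timePart_smul_Pl (t : ℝ) (x y : Fin 4 → ℝ) :
    timePart (t • Pl (lift x) (lift y)) = t • (y - x) := by
  ext j
  simp [timePart, Pl, lift]

lemma spacePart_smul_Pl (t : ℝ) (x y : Fin 4 → ℝ) :
    spacePart (t • Pl (lift x) (lift y)) = t • (vecMulVec x y - vecMulVec y x) := by
  ext i j
  rcases lt_trichotomy i j with h | rfl | h
  · simp [spacePart, h, Pl, lift, vecMulVec_apply, -mul_eq_mul_left_iff]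
    ring
  · simp [spacePart, vecMulVec_apply, mul_comm]
  · simp [spacePart, h, h.not_gt, Pl, lift, vecMulVec_apply]
    ring

lemma spacePart_swap (v : PIdx → ℝ) (i j : Fin 4) : spacePart v j i = -spacePart v i j := by
  rcases lt_trichotomy i j with h | rfl | h <;> simp [spacePart, *, not_lt_of_gt]

lemma timePart_wedge_spacePart {v : PIdx → ℝ} (hv : v ∈ Theta03) (i j k : Fin 4) :
    timePart v i * spacePart v j k - timePart v j * spacePart v i k
      + timePart v k * spacePart v i j = 0 := by
  have h (i j k : Fin 4) (hij : i < j) (hjk : j < k) :=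
    hv.2 0 i.succ j.succ k.succ i.succ_pos (Fin.succ_lt_succ_iff.2 hij)
      (Fin.succ_lt_succ_iff.2 hjk)
  have h₁ := h 0 1 2 (by decide) (by decide)
  have h₂ := h 0 1 3 (by decide) (by decide)
  have h₃ := h 0 2 3 (by decide) (by decide)
  have h₄ := h 1 2 3 (by decide) (by decide)
  fin_cases i <;> fin_cases j <;> fin_cases k <;> simp [timePart, spacePart] at * <;> linarith

lemma dotProduct_mulVec_spacePart (v : PIdx → ℝ) :
    timePart v ⬝ᵥ (spacePart v *ᵥ timePart v) = 0 := by
  have h : (spacePart v)ᵀ = -spacePart v := by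
    ext i j
    exact spacePart_swap v i j
  have h' := dotProduct_mulVec (timePart v) (spacePart v) (timePart v)
  rw [← mulVec_transpose, h, neg_mulVec, neg_dotProduct, dotProduct_comm _ (timePart v)] at h'
  linarith

lemma dotProduct_smul_spacePart {v : PIdx → ℝ} (hv : v ∈ Theta03) (i j : Fin 4) :
    (timePart v ⬝ᵥ timePart v) * spacePart v i j =
      (spacePart v *ᵥ timePart v) i * timePart v j
        - timePart v i * (spacePart v *ᵥ timePart v) j := by
  simp only [dotProduct, mulVec, Finset.sum_mul, Finset.mul_sum, ← Finset.sum_sub_distrib]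
  refine Finset.sum_congr rfl fun k _ => ?_
  linear_combination timePart v k * timePart_wedge_spacePart hv i j k

lemma mulVec_spacePart_dotProduct_self {v : PIdx → ℝ} (hv : v ∈ Theta03) :
    (spacePart v *ᵥ timePart v) ⬝ᵥ (spacePart v *ᵥ timePart v) =
      (timePart v ⬝ᵥ timePart v) * (timePart v ⬝ᵥ timePart v - 1) := by
  have hQ := hv.1
  rw [Q_self_eq] at hQ
  have h : (timePart v ⬝ᵥ timePart v) * ∑ i, ∑ j, spacePart v i j ^ 2 =
      2 * ((spacePart v *ᵥ timePart v) ⬝ᵥ (spacePart v *ᵥ timePart v)) := by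
    set b := spacePart v *ᵥ timePart v with hb
    have h₁ : ∑ i, ∑ j, b i * (spacePart v i j * timePart v j) = b ⬝ᵥ b := by
      simp_rw [← Finset.mul_sum]
      rfl
    have h₂ : ∑ i, ∑ j, timePart v i * b j * spacePart v i j = -(b ⬝ᵥ b) := by
      rw [Finset.sum_comm, ← h₁, ← Finset.sum_neg_distrib]
      refine Finset.sum_congr rfl fun i _ => ?_
      rw [← Finset.sum_neg_distrib]
      refine Finset.sum_congr rfl fun j _ => ?_
      rw [spacePart_swap v i j]
      ring
    rw [two_mul, ← sub_neg_eq_add, ← h₂]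
    nth_rw 1 [← h₁]
    simp only [Finset.mul_sum, ← Finset.sum_sub_distrib]
    refine Finset.sum_congr rfl fun i _ => Finset.sum_congr rfl fun j _ => ?_
    linear_combination spacePart v i j * dotProduct_smul_spacePart hv i j
  linear_combination -h / 2 - (timePart v ⬝ᵥ timePart v) * hQ

lemma one_le_timePart_dotProduct_self {v : PIdx → ℝ} (hv : v ∈ Theta03) :
    1 ≤ timePart v ⬝ᵥ timePart v := by
  have hQ := hv.1
  rw [Q_self_eq] at hQ
  have : 0 ≤ ∑ i, ∑ j, spacePart v i j ^ 2 := by positivity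
  linarith

/-- The pair of points of `S³` recovered from a vector of `Θ(0,3)`. -/
noncomputable def endpoints (v : PIdx → ℝ) : (Fin 4 → ℝ) × (Fin 4 → ℝ) :=
  ((timePart v ⬝ᵥ timePart v)⁻¹ • (spacePart v *ᵥ timePart v - timePart v),
    (timePart v ⬝ᵥ timePart v)⁻¹ • (spacePart v *ᵥ timePart v + timePart v))

lemma one_sub_dotProduct_ne_zero {x y : Fin 4 → ℝ} (hx : x ⬝ᵥ x = 1) (hy : y ⬝ᵥ y = 1)
    (hxy : x ≠ y) : 1 - x ⬝ᵥ y ≠ 0 := by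
  intro h
  refine hxy (sub_eq_zero.1 (dotProduct_self_eq_zero.1 ?_))
  simp only [sub_dotProduct, dotProduct_sub, dotProduct_comm y x]
  linarith

lemma endpoints_smul_Pl {x y : Fin 4 → ℝ} (hx : x ⬝ᵥ x = 1) (hy : y ⬝ᵥ y = 1) (hxy : x ≠ y) :
    endpoints ((1 - x ⬝ᵥ y)⁻¹ • Pl (lift x) (lift y)) = (x, y) := by
  have hc := one_sub_dotProduct_ne_zero hx hy hxy
  have ha : ((1 - x ⬝ᵥ y)⁻¹ • (y - x)) ⬝ᵥ ((1 - x ⬝ᵥ y)⁻¹ • (y - x)) =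
      2 * (1 - x ⬝ᵥ y)⁻¹ := by
    simp only [smul_dotProduct, dotProduct_smul, sub_dotProduct, dotProduct_sub,
      dotProduct_comm y x, hx, hy, smul_eq_mul]
    field_simp
    ring
  have hb : ((1 - x ⬝ᵥ y)⁻¹ • (vecMulVec x y - vecMulVec y x)) *ᵥ
      ((1 - x ⬝ᵥ y)⁻¹ • (y - x)) = (1 - x ⬝ᵥ y)⁻¹ • (x + y) := by
    ext i
    simp only [smul_mulVec, mulVec_smul, sub_mulVec, vecMulVec_mulVec, dotProduct_sub,
      dotProduct_comm y x, hx, hy, Pi.smul_apply, Pi.sub_apply, Pi.add_apply, smul_eq_mul,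
      MulOpposite.smul_eq_mul_unop, MulOpposite.unop_op]
    field_simp
    ring
  simp only [endpoints, timePart_smul_Pl, spacePart_smul_Pl, ha, hb]
  ext i <;> simp <;> field_simp <;> ring

lemma smul_Pl_mem_Theta03 {x y : Fin 4 → ℝ} (hx : x ⬝ᵥ x = 1) (hy : y ⬝ᵥ y = 1) (hxy : x ≠ y) :
    (1 - x ⬝ᵥ y)⁻¹ • Pl (lift x) (lift y) ∈ Theta03 := by
  refine ⟨?_, fun i j k l _ _ _ => ?_⟩
  · have hc := one_sub_dotProduct_ne_zero hx hy hxy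
    have hB : ∑ i, ∑ j, (x i * y j - y i * x j) ^ 2 =
        2 * ((x ⬝ᵥ x) * (y ⬝ᵥ y) - (x ⬝ᵥ y) ^ 2) := by
      simp only [dotProduct, Fin.sum_univ_four]
      ring
    rw [Q_self_eq, timePart_smul_Pl, spacePart_smul_Pl]
    simp only [smul_dotProduct, dotProduct_smul, sub_dotProduct, dotProduct_sub, Matrix.smul_apply,
      Matrix.sub_apply, vecMulVec_apply, mul_pow, smul_eq_mul, ← Finset.mul_sum, hB,
      dotProduct_comm y x, hx, hy]
    field_simp
    ring
  · simp only [Pl, Pi.smul_apply, smul_eq_mul]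
    ring

lemma endpoints_dotProduct {v : PIdx → ℝ} (hv : v ∈ Theta03) :
    (endpoints v).1 ⬝ᵥ (endpoints v).1 = 1 ∧ (endpoints v).2 ⬝ᵥ (endpoints v).2 = 1 ∧
      1 - (endpoints v).1 ⬝ᵥ (endpoints v).2 = 2 * (timePart v ⬝ᵥ timePart v)⁻¹ := by
  have hpos := one_le_timePart_dotProduct_self hv
  have hne : timePart v ⬝ᵥ timePart v ≠ 0 := by positivity
  simp only [endpoints, smul_dotProduct, dotProduct_smul, sub_dotProduct, dotProduct_sub,
    add_dotProduct, dotProduct_add, dotProduct_comm (spacePart v *ᵥ timePart v) (timePart v),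
    dotProduct_mulVec_spacePart, mulVec_spacePart_dotProduct_self hv, smul_eq_mul]
  refine ⟨?_, ?_, ?_⟩ <;> field_simp <;> ring

lemma endpoints_mem_spherePairs {v : PIdx → ℝ} (hv : v ∈ Theta03) :
    endpoints v ∈ spherePairs := by
  obtain ⟨h₁, h₂, h₃⟩ := endpoints_dotProduct hv
  have hpos := one_le_timePart_dotProduct_self hv
  refine ⟨h₁, h₂, fun h => ?_⟩
  have : 0 < 2 * (timePart v ⬝ᵥ timePart v)⁻¹ := by positivity
  rw [← h₃, ← h, h₁] at this
  linarith

lemma smul_Pl_endpoints {v : PIdx → ℝ} (hv : v ∈ Theta03) :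
    (1 - (endpoints v).1 ⬝ᵥ (endpoints v).2)⁻¹ •
      Pl (lift (endpoints v).1) (lift (endpoints v).2) = v := by
  have hpos := one_le_timePart_dotProduct_self hv
  have hne : timePart v ⬝ᵥ timePart v ≠ 0 := by positivity
  rw [(endpoints_dotProduct hv).2.2]
  apply ext_timePart_spacePart
  · rw [timePart_smul_Pl]
    ext i
    simp only [endpoints, Pi.smul_apply, Pi.sub_apply, Pi.add_apply, smul_eq_mul]
    field_simp
    ring
  · rw [spacePart_smul_Pl]
    ext i j
    have h := dotProduct_smul_spacePart hv i j
    simp only [endpoints, Matrix.smul_apply, Matrix.sub_apply, vecMulVec_apply, Pi.smul_apply, Pi.sub_apply,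
      Pi.add_apply, smul_eq_mul]
    field_simp
    linear_combination -2 * h

/-- the normalized Plüccker map
`ψ(x,y) = P(x̄,ȳ)/(1 − x·y)` is a bijection from the set of pairs of distinct points of
`S³` onto `Θ(0,3)`. -/
theorem psi_bijection_onto_Theta03 :
    Set.BijOn (fun p : (Fin 4 → ℝ) × (Fin 4 → ℝ) =>
        (1 - p.1 ⬝ᵥ p.2)⁻¹ • Pl (lift p.1) (lift p.2))
      spherePairs Theta03 :=
  Set.InvOn.bijOn (f' := endpoints)
    ⟨fun _ hp => endpoints_smul_Pl hp.1 hp.2.1 hp.2.2, fun _ hv => smul_Pl_endpoints hv⟩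
    (fun _ hp => smul_Pl_mem_Theta03 hp.1 hp.2.1 hp.2.2)
    (fun _ hv => endpoints_mem_spherePairs hv)
end
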